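/- arXiv:2509.00363 — 2 statements merged into one kernel-verified Lean document; each statement's English description precedes it below -/
import Mathlib

section
/- Let M be a module over a ring A, α an ordinal, f : [0,α) → M a function, and β ∈ [0,α). If M is β-Noetherian, then there exist m ∈ ℕ and a strictly decreasing sequence α_0 > ... > α_{m-1} in [0,α) such that the list [f(α_0),...,f(α_{m-1})] is good, i.e., m ≥ 1 and f(α_{m-1}) lies in the submodule generated by f(α_0),...,f(α_{m-2}). -/
open Ordinal

/-- A list is good ((-1)-good) if it is nonempty and its last entry lies in the
submodule generated by the preceding entries. -/
def GoodList (A : Type*) {M : Type*} [Ring A] [AddCommGroup M] [Module A M]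
    (σ : List M) : Prop :=
  ∃ (l : List M) (x : M), σ = l ++ [x] ∧ x ∈ Submodule.span A {y | y ∈ l}

/-- A list `σ` is `α`-good if for every `x`, the appended list `σ.x` is either good
((-1)-good) or `β`-good for some ordinal `β < α`.  A module `M` is `α`-Noetherian
if the empty list `[] : List M` is `α`-good; a ring is `α`-Noetherian if it is
`α`-Noetherian as a left module over itself. -/
def AlphaGood (A : Type*) {M : Type*} [Ring A] [AddCommGroup M] [Module A M]
    (α : Ordinal) (σ : List M) : Prop :=
  ∀ x : M, GoodList A (σ ++ [x]) ∨ ∃ (β : Ordinal) (_ : β < α), AlphaGood A β (σ ++ [x])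
termination_by α

/-- Responding to a `β`-good list of values of `f` with `f β` repeatedly extends a strictly
decreasing list of ordinals above `β` until the list of values becomes good. -/
theorem AlphaGood.exists_pairwise_gt {A M : Type*} [Ring A] [AddCommGroup M] [Module A M]
    (α : Ordinal) (f : Ordinal → M) (β : Ordinal) (hβ : β < α) (L : List Ordinal)
    (hL : L.Pairwise (· > ·)) (hLα : ∀ o ∈ L, o < α) (hLβ : ∀ o ∈ L, β < o)
    (hN : AlphaGood A β (L.map f)) :
    ∃ L' : List Ordinal, L'.Pairwise (· > ·) ∧ (∀ o ∈ L', o < α) ∧ GoodList A (L'.map f) := by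
  induction β using WellFoundedLT.induction generalizing L with
  | ind β ih =>
    have hpair : (L ++ [β]).Pairwise (· > ·) := by
      simpa [List.pairwise_append] using ⟨hL, hLβ⟩
    have hlt : ∀ o ∈ L ++ [β], o < α := by
      simpa [or_imp, forall_and] using ⟨hLα, hβ⟩
    have hmap : L.map f ++ [f β] = (L ++ [β]).map f := by simp
    rw [AlphaGood] at hN
    rcases hN (f β) with h | ⟨γ, hγ, h⟩
    · exact ⟨L ++ [β], hpair, hlt, hmap ▸ h⟩
    · refine ih γ hγ (hγ.trans hβ) (L ++ [β]) hpair hlt ?_ (hmap ▸ h)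
      simpa [or_imp, forall_and] using ⟨fun o ho => hγ.trans (hLβ o ho), hγ⟩

/-- If `M` is `β`-Noetherian for some `β < α`, then for any `f : [0, α) → M` there
is a strictly decreasing sequence of ordinals in `[0, α)` whose list of values
under `f` is good. -/
theorem exists_good_list_of_alphaNoetherian {A M : Type*} [Ring A] [AddCommGroup M]
    [Module A M] (α : Ordinal) (f : Ordinal → M) (β : Ordinal) (hβ : β < α)
    (hN : AlphaGood A β ([] : List M)) :
    ∃ (m : ℕ) (g : Fin m → Ordinal), StrictAnti g ∧ (∀ i : Fin m, g i < α) ∧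
      GoodList A (List.ofFn fun i => f (g i)) := by
  obtain ⟨L, hL, hLα, hgood⟩ :=
    AlphaGood.exists_pairwise_gt (A := A) α f β hβ [] List.Pairwise.nil (by simp) (by simp) hN
  refine ⟨L.length, L.get, fun i j hij => List.pairwise_iff_get.mp hL i j hij,
    fun i => hLα _ (L.get_mem i), ?_⟩
  rwa [← Function.comp_def, ← List.map_ofFn, List.ofFn_get]
end

section
/- For a discrete field K and n ∈ ℕ, the polynomial ring K[X_1,...,X_n] is ω^n-Noetherian; in particular, Kdim K[X_1,...,X_n] < 1 + n in the sense of Lombardi's elementary characterization. -/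
open Ordinal

/-- Lombardi's elementary characterization of `Kdim A < n`. -/
def KdimLt (A : Type*) [CommRing A] (n : ℕ) : Prop :=
  ∀ x : Fin n → A, ∃ e : Fin n → ℕ,
    (∏ i, x i ^ e i) ∈ Ideal.span (Set.range fun i : Fin n =>
      (∏ j ∈ Finset.univ.filter (fun j => j < i), x j ^ e j) * x i ^ (e i + 1))

/-! ### Goodness from a rank function on submodules -/

theorem goodList_append_singleton {A M : Type*} [Ring A] [AddCommGroup M] [Module A M]
    {σ : List M} {x : M} (hx : x ∈ Submodule.span A {y | y ∈ σ}) : GoodList A (σ ++ [x]) :=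
  ⟨σ, x, rfl, hx⟩

/-- A strictly antitone ordinal-valued function on submodules bounds the rank at which a list
is good. -/
theorem alphaGood_of_strictAnti {A M : Type*} [Ring A] [AddCommGroup M] [Module A M]
    {o : Submodule A M → Ordinal} (ho : StrictAnti o) (σ : List M) :
    AlphaGood A (o (Submodule.span A {y | y ∈ σ})) σ := by
  generalize hα : o (Submodule.span A {y | y ∈ σ}) = α
  induction α using WellFoundedLT.induction generalizing σ with
  | ind α ih =>
    subst hα
    rw [AlphaGood]
    intro x
    by_cases hx : x ∈ Submodule.span A {y | y ∈ σ}
    · exact Or.inl (goodList_append_singleton hx)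
    · refine Or.inr ⟨_, ?_, ih _ ?_ (σ ++ [x]) rfl⟩ <;>
      · refine ho (lt_of_le_of_ne (Submodule.span_mono fun y hy => ?_) fun h => hx ?_)
        · exact List.mem_append_left _ hy
        · rw [h]
          exact Submodule.subset_span (by simp)

/-! ### Ordinals in Cantor normal form with natural number coefficients -/

/-- The ordinal `ω ^ (N - 1) * c (N - 1) + ⋯ + ω * c 1 + c 0`. -/
noncomputable def cantorSum (c : ℕ → ℕ) : ℕ → Ordinal
  | 0 => 0
  | k + 1 => omega0 ^ (k : Ordinal) * (c k : Ordinal) + cantorSum c k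

theorem cantorSum_lt (c : ℕ → ℕ) (N : ℕ) : cantorSum c N < omega0 ^ (N : Ordinal) := by
  induction N with
  | zero => simp [cantorSum]
  | succ k ih =>
    rw [cantorSum]
    exact opow_mul_add_lt_opow (natCast_lt_omega0 _) ih (by exact_mod_cast Nat.lt_succ_self k)

theorem cantorSum_lt_cantorSum {c d : ℕ → ℕ} {k N : ℕ} (hk : k < N) (hlt : c k < d k)
    (heq : ∀ j, k < j → c j = d j) : cantorSum c N < cantorSum d N := by
  induction N with
  | zero => omega
  | succ N ih =>
    rw [cantorSum, cantorSum]
    rcases (Nat.lt_succ_iff.mp hk).eq_or_lt with rfl | h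
    · exact (opow_mul_add_lt_opow_mul (cantorSum_lt c k) (by exact_mod_cast hlt)).trans_le
        le_self_add
    · rw [heq N h]
      gcongr
      exact ih h

/-! ### Maximal boxes in sets of exponents -/

section Boxes

variable {ι : Type*}

/-- The exponents bounded by a vector `v` with possibly infinite entries. -/
def exponentBox (v : ι → ℕ∞) : Set (ι →₀ ℕ) := {x | ∀ i, (x i : ℕ∞) ≤ v i}

open Classical in
/-- The vectors whose box lies in `D` but leaves `D` once any finite entry is made infinite. -/
def maximalBoxes (D : Set (ι →₀ ℕ)) : Set (ι → ℕ∞) :=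
  {v | exponentBox v ⊆ D ∧ ∀ i, v i ≠ ⊤ → ¬ exponentBox (Function.update v i ⊤) ⊆ D}

theorem exponentBox_mono {v w : ι → ℕ∞} (h : v ≤ w) : exponentBox v ⊆ exponentBox w :=
  fun _ hx i => (hx i).trans (h i)

theorem finite_maximalBoxes [Finite ι] (D : Set (ι →₀ ℕ)) : (maximalBoxes D).Finite := by
  classical
  cases nonempty_fintype ι
  by_contra hinf
  obtain ⟨f, hf, hfD⟩ : ∃ f : ℕ → ι → ℕ∞, Function.Injective f ∧ ∀ k, f k ∈ maximalBoxes D :=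
    ⟨fun k => (Set.Infinite.natEmbedding _ hinf k : ι → ℕ∞),
      fun a b h => (Set.Infinite.natEmbedding _ hinf).injective (Subtype.ext h),
      fun k => (Set.Infinite.natEmbedding _ hinf k).2⟩
  obtain ⟨g, hg⟩ := (wellQuasiOrdered_le (α := ι → ℕ∞)).exists_monotone_subseq f
  have hmono : Monotone (f ∘ g) := fun a b h => hg a b h
  have hstrict : StrictMono (f ∘ g) := hmono.strictMono_of_injective (hf.comp g.injective)
  obtain ⟨i, hi⟩ : ∃ i, ∀ k, ∃ l, (f ∘ g) k i < (f ∘ g) l i := by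
    by_contra! h
    choose k hk using h
    refine (hstrict (Nat.lt_succ_self (Finset.univ.sup k))).not_ge fun i => ?_
    exact (hk i _).trans (hmono (Finset.le_sup (Finset.mem_univ i)) i)
  have hunb : ∀ N : ℕ, ∃ k, (N : ℕ∞) ≤ (f ∘ g) k i := by
    intro N
    induction N with
    | zero => exact ⟨0, by simp⟩
    | succ N ih =>
      obtain ⟨k, hk⟩ := ih
      obtain ⟨l, hl⟩ := hi k
      exact ⟨l, by push_cast; exact Order.add_one_le_of_lt (hk.trans_lt hl)⟩
  obtain ⟨l, hl⟩ := hi 0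
  refine (hfD (g 0)).2 i hl.ne_top fun x hx => ?_
  obtain ⟨k, hk⟩ := hunb (x i)
  refine (hfD (g k)).1 fun j => ?_
  by_cases hj : j = i
  · subst hj
    exact hk
  · have := hx j
    rw [Function.update_of_ne hj] at this
    exact this.trans (hmono (Nat.zero_le k) j)

variable [Fintype ι]

/-- The number of infinite entries of `v`. -/
noncomputable def infiniteEntries (v : ι → ℕ∞) : ℕ := by
  classical exact (Finset.univ.filter fun i => v i = ⊤).card

theorem infiniteEntries_le (v : ι → ℕ∞) : infiniteEntries v ≤ Fintype.card ι :=
  Finset.card_le_univ _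

theorem infiniteEntries_eq_card_iff {v : ι → ℕ∞} :
    infiniteEntries v = Fintype.card ι ↔ ∀ i, v i = ⊤ := by
  classical
  unfold infiniteEntries
  rw [Finset.card_eq_iff_eq_univ, Finset.filter_eq_self]
  simp

open Classical in
theorem infiniteEntries_update {v : ι → ℕ∞} {i : ι} (hi : v i ≠ ⊤) :
    infiniteEntries v < infiniteEntries (Function.update v i ⊤) := by
  unfold infiniteEntries
  refine Finset.card_lt_card ⟨fun j hj => ?_, fun h => hi ?_⟩
  · by_cases h : j = i
    · simp [h]
    · simpa [Function.update_of_ne h] using hj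
  · simpa using h (show i ∈ _ by simp)

/-- The number of maximal boxes of `D` with exactly `k` infinite sides. -/
noncomputable def countBoxes (D : Set (ι →₀ ℕ)) (k : ℕ) : ℕ :=
  (maximalBoxes D ∩ {v | infiniteEntries v = k}).ncard

theorem exists_countBoxes_lt {D E : Set (ι →₀ ℕ)} (hE : IsLowerSet E) (hDE : D ⊂ E) :
    ∃ k ≤ Fintype.card ι, countBoxes D k < countBoxes E k ∧
      ∀ j, k < j → countBoxes D j = countBoxes E j := by
  classical
  let Q : ℕ → Prop := fun k =>
    ∃ v : ι → ℕ∞, infiniteEntries v = k ∧ exponentBox v ⊆ E ∧ ¬ exponentBox v ⊆ D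
  obtain ⟨x, hxE, hxD⟩ := Set.exists_of_ssubset hDE
  have hQ0 : Q 0 := by
    refine ⟨fun i => (x i : ℕ∞), by simp [infiniteEntries], fun y hy => ?_, fun h => ?_⟩
    · exact hE (fun i => Nat.cast_le.mp (hy i)) hxE
    · exact hxD (h fun i => le_rfl)
  obtain ⟨v, hvk, hvE, hvD⟩ : Q (Nat.findGreatest Q (Fintype.card ι)) :=
    Nat.findGreatest_spec (Nat.zero_le _) hQ0
  have hmax : ∀ w : ι → ℕ∞, Nat.findGreatest Q (Fintype.card ι) < infiniteEntries w →
      exponentBox w ⊆ E → exponentBox w ⊆ D := by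
    intro w hw hwE
    by_contra hwD
    exact Nat.findGreatest_is_greatest hw (infiniteEntries_le w) ⟨w, rfl, hwE, hwD⟩
  generalize Nat.findGreatest Q (Fintype.card ι) = k at hvk hmax
  subst hvk
  have hsub : ∀ w ∈ maximalBoxes D, infiniteEntries v ≤ infiniteEntries w →
      w ∈ maximalBoxes E := fun w hw hvw =>
    ⟨hw.1.trans hDE.subset, fun i hi h =>
      hw.2 i hi (hmax _ (hvw.trans_lt (infiniteEntries_update hi)) h)⟩
  refine ⟨_, infiniteEntries_le v, Set.ncard_lt_ncard ⟨fun w hw => ?_, fun h => ?_⟩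
    ((finite_maximalBoxes E).inter_of_left _), fun j hj => ?_⟩
  · exact ⟨hsub w hw.1 hw.2.ge, hw.2⟩
  · refine hvD (h ⟨⟨hvE, fun i hi hu => hvD ?_⟩, rfl⟩).1.1
    refine (exponentBox_mono ?_).trans (hmax _ (infiniteEntries_update hi) hu)
    exact le_update_iff.mpr ⟨le_top, fun _ _ => le_rfl⟩
  · unfold countBoxes
    congr 1
    ext w
    refine and_congr_left fun hw => ?_
    have hw' : infiniteEntries w = j := hw
    refine ⟨fun h => hsub w h (by omega), fun h => ⟨hmax w (by omega) h.1, fun i hi hu => ?_⟩⟩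
    exact h.2 i hi (hu.trans hDE.subset)

theorem countBoxes_card {D : Set (ι →₀ ℕ)} (hD : D ≠ Set.univ) :
    countBoxes D (Fintype.card ι) = 0 := by
  rw [countBoxes, Set.ncard_eq_zero ((finite_maximalBoxes D).inter_of_left _),
    Set.eq_empty_iff_forall_notMem]
  rintro v ⟨hv, hcard⟩
  refine hD (Set.eq_univ_of_forall fun x => hv.1 fun i => ?_)
  rw [infiniteEntries_eq_card_iff.mp hcard i]
  exact le_top

/-- An ordinal measuring the size of a lower set of exponents. -/
noncomputable def lowerSetRank (D : Set (ι →₀ ℕ)) : Ordinal :=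
  cantorSum (countBoxes D) (Fintype.card ι + 1)

theorem lowerSetRank_lt_lowerSetRank {D E : Set (ι →₀ ℕ)} (hE : IsLowerSet E) (hDE : D ⊂ E) :
    lowerSetRank D < lowerSetRank E := by
  obtain ⟨k, hk, hlt, heq⟩ := exists_countBoxes_lt hE hDE
  exact cantorSum_lt_cantorSum (Nat.lt_succ_of_le hk) hlt heq

theorem lowerSetRank_lt {D : Set (ι →₀ ℕ)} (hD : D ≠ Set.univ) :
    lowerSetRank D < omega0 ^ (Fintype.card ι : Ordinal) := by
  rw [lowerSetRank, cantorSum, countBoxes_card hD]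
  simpa using cantorSum_lt _ _

end Boxes

/-! ### Standard monomials of an ideal -/

section StandardMonomials

variable {ι K : Type*} [Field K] (m : MonomialOrder ι)

/-- The exponents that are not leading exponents of nonzero elements of `I`. -/
def standardMonomials (I : Ideal (MvPolynomial ι K)) : Set (ι →₀ ℕ) :=
  {a | ∀ f ∈ I, f ≠ 0 → m.degree f ≠ a}

theorem isLowerSet_standardMonomials (I : Ideal (MvPolynomial ι K)) :
    IsLowerSet (standardMonomials m I) := by
  classical
  intro a b hba ha f hf hf0 hfb
  have hmon : MvPolynomial.monomial (a - b) (1 : K) ≠ 0 := by simp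
  refine ha (MvPolynomial.monomial (a - b) 1 * f) (I.mul_mem_left _ hf) (mul_ne_zero hmon hf0) ?_
  rw [m.degree_mul hmon hf0, m.degree_monomial, hfb]
  simp [tsub_add_cancel_of_le hba]

theorem standardMonomials_ssubset {I J : Ideal (MvPolynomial ι K)} (h : I < J) :
    standardMonomials m J ⊂ standardMonomials m I := by
  refine ⟨fun a ha f hf => ha f (h.le hf), fun hsub => h.not_ge fun f hf => ?_⟩
  generalize hd : m.toSyn (m.degree f) = d
  induction d using WellFoundedLT.induction generalizing f with
  | ind d ih =>
    by_contra hfI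
    have hf0 : f ≠ 0 := fun h0 => hfI (h0 ▸ I.zero_mem)
    obtain ⟨g, hgI, hg0, hgd⟩ : ∃ g ∈ I, g ≠ 0 ∧ m.degree g = m.degree f := by
      by_contra! hno
      exact hsub hno f hf hf0 rfl
    set c : K := m.leadingCoeff f / m.leadingCoeff g
    have hcg : MvPolynomial.C c * g ∈ I := I.mul_mem_left _ hgI
    have hr : f - MvPolynomial.C c * g ∉ I := fun hr => hfI (by simpa using I.add_mem hr hcg)
    refine hr (ih _ ?_ _ (J.sub_mem hf (h.le hcg)) rfl)
    have hcoeff : (f - MvPolynomial.C c * g).coeff (m.degree f) = 0 := by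
      rw [MvPolynomial.coeff_sub, MvPolynomial.coeff_C_mul]
      nth_rewrite 2 [← hgd]
      change m.leadingCoeff f - c * m.leadingCoeff g = 0
      rw [div_mul_cancel₀ _ (m.leadingCoeff_ne_zero_iff.mpr hg0)]
      exact sub_self _
    have hr0 : f - MvPolynomial.C c * g ≠ 0 := fun h0 => hr (h0 ▸ I.zero_mem)
    rw [← hd]
    refine lt_of_le_of_ne ?_ fun heq => ?_
    · refine m.degree_sub_le.trans (sup_le le_rfl ?_)
      rw [← MvPolynomial.smul_eq_C_mul, ← hgd]
      exact m.degree_smul_le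
    · rw [← m.toSyn.injective heq] at hcoeff
      exact m.coeff_degree_ne_zero_iff.mpr hr0 hcoeff

theorem strictAnti_lowerSetRank_standardMonomials [Fintype ι] :
    StrictAnti fun I : Ideal (MvPolynomial ι K) => lowerSetRank (standardMonomials m I) :=
  fun I _ h =>
    lowerSetRank_lt_lowerSetRank (isLowerSet_standardMonomials m I) (standardMonomials_ssubset m h)

end StandardMonomials

theorem alphaGood_mvPolynomial_nil (K : Type*) [Field K] (n : ℕ) :
    AlphaGood (MvPolynomial (Fin n) K) (omega0 ^ (n : Ordinal))
      ([] : List (MvPolynomial (Fin n) K)) := by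
  rw [AlphaGood]
  intro x
  by_cases hx : x = 0
  · exact Or.inl (goodList_append_singleton (by simp [hx]))
  · refine Or.inr ⟨_, ?_, alphaGood_of_strictAnti
      (strictAnti_lowerSetRank_standardMonomials (MonomialOrder.lex (σ := Fin n))) _⟩
    have := lowerSetRank_lt (D := standardMonomials (MonomialOrder.lex (σ := Fin n))
      (Ideal.span {y | y ∈ ([] : List (MvPolynomial (Fin n) K)) ++ [x]})) fun h => ?_
    · simpa using this
    · exact (Set.eq_univ_iff_forall.mp h (MonomialOrder.lex.degree x)) x
        (Ideal.subset_span (by simp)) hx rfl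

/-! ### Krull dimension -/

/-- Elements satisfying a nontrivial polynomial relation over a field satisfy the relation of
Lombardi's characterization of the Krull dimension. -/
theorem exists_prod_pow_mem_of_not_algebraicIndependent {K A : Type*} [Field K] [CommRing A]
    [Algebra K A] {m : ℕ} {x : Fin m → A} (hx : ¬ AlgebraicIndependent K x) :
    ∃ e : Fin m → ℕ, (∏ i, x i ^ e i) ∈ Ideal.span (Set.range fun i : Fin m =>
      (∏ j ∈ Finset.univ.filter (fun j => j < i), x j ^ e j) * x i ^ (e i + 1)) := by
  classical
  obtain ⟨P, hP, hP0⟩ : ∃ P : MvPolynomial (Fin m) K, MvPolynomial.aeval x P = 0 ∧ P ≠ 0 := by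
    by_contra! h
    exact hx ((algebraicIndependent_iff).mpr h)
  obtain ⟨e, heP, hmin⟩ := Finset.exists_min_image P.support (fun a => toLex a)
    (MvPolynomial.support_nonempty.mpr hP0)
  refine ⟨e, ?_⟩
  set I := Ideal.span (Set.range fun i : Fin m =>
      (∏ j ∈ Finset.univ.filter (fun j => j < i), x j ^ e j) * x i ^ (e i + 1))
  have hmem : ∀ a ∈ P.support.erase e, ∏ i, x i ^ a i ∈ I := by
    intro a ha
    obtain ⟨hne, haP⟩ := Finset.mem_erase.mp ha
    obtain ⟨i, hlt, hi⟩ := Finsupp.Lex.lt_iff.mp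
      (lt_of_le_of_ne (hmin a haP) fun h => hne (toLex.injective h).symm)
    refine I.mem_of_dvd ?_ (Ideal.subset_span ⟨i, rfl⟩)
    have hsplit := Finset.prod_dvd_prod_of_subset
      (insert i (Finset.univ.filter fun j => j < i)) Finset.univ (fun j => x j ^ a j)
      (Finset.subset_univ _)
    rw [Finset.prod_insert (by simp)] at hsplit
    refine dvd_trans ?_ hsplit
    refine (mul_comm _ _).dvd.trans (mul_dvd_mul (pow_dvd_pow _ hi) (Finset.prod_dvd_prod_of_dvd _ _ fun j hj => ?_))
    exact pow_dvd_pow _ (hlt j (Finset.mem_filter.mp hj).2).le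
  rw [MvPolynomial.aeval_def, MvPolynomial.eval₂_eq', ← Finset.add_sum_erase _ _ heP] at hP
  have hsum : algebraMap K A (P.coeff e) * ∏ i, x i ^ e i ∈ I := by
    rw [eq_neg_of_add_eq_zero_left hP]
    exact I.neg_mem (I.sum_mem fun a ha => I.mul_mem_left _ (hmem a ha))
  have hunit : algebraMap K A (P.coeff e)⁻¹ * algebraMap K A (P.coeff e) = 1 := by
    rw [← map_mul, inv_mul_cancel₀ (MvPolynomial.mem_support_iff.mp heP), map_one]
  simpa [← mul_assoc, hunit] using I.mul_mem_left (algebraMap K A (P.coeff e)⁻¹) hsum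

theorem kdimLt_mvPolynomial (K : Type*) [Field K] (n : ℕ) :
    KdimLt (MvPolynomial (Fin n) K) (1 + n) := by
  refine fun x => exists_prod_pow_mem_of_not_algebraicIndependent (K := K) fun hx => ?_
  have h := hx.lift_cardinalMk_le_trdeg
  rw [MvPolynomial.trdeg_of_isDomain] at h
  simp only [Cardinal.mk_fin, Cardinal.lift_natCast, Nat.cast_le] at h
  omega

/-- For a discrete field `K`, the polynomial ring `K[X₁, …, Xₙ]` is
`ω ^ n`-Noetherian; in particular its Krull dimension is `< 1 + n` in the sense
of Lombardi. -/
theorem mvPolynomial_noetherian_and_kdim (K : Type*) [Field K] [DecidableEq K] (n : ℕ) :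
    AlphaGood (MvPolynomial (Fin n) K) (Ordinal.omega0 ^ (n : Ordinal))
      ([] : List (MvPolynomial (Fin n) K)) ∧
    KdimLt (MvPolynomial (Fin n) K) (1 + n) := by
  exact ⟨alphaGood_mvPolynomial_nil K n, kdimLt_mvPolynomial K n⟩
end
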